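/- Let α, β, l be complex numbers with exp(l) = α, α ≠ 0, α ≠ 1, such that α and β are both algebraic over ℚ and β is irrational (i.e., β is not in the image of ℚ in ℂ). Then the complex number α^β = exp(β·l) is transcendental over ℚ. -/

import Mathlib

theorem exists_differentiable_eq_prod_sub_mul (Z : Finset ℂ) :
    ∀ f : ℂ → ℂ, Differentiable ℂ f → (∀ w ∈ Z, f w = 0) →
      ∃ g : ℂ → ℂ, Differentiable ℂ g ∧ ∀ z, f z = (∏ w ∈ Z, (z - w)) * g z := by
  classical
  induction Z using Finset.induction_on with
  | empty => exact fun f hf _ => ⟨f, hf, by simp⟩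
  | insert a s ha ih =>
    intro f hf h0
    have hfa : f a = 0 := h0 a (Finset.mem_insert_self a s)
    have hmul (z : ℂ) : (z - a) * dslope f a z = f z := by
      simpa [hfa] using sub_smul_dslope f a z
    have hd : Differentiable ℂ (dslope f a) := by
      rw [← differentiableOn_univ] at hf ⊢
      exact (Complex.differentiableOn_dslope Filter.univ_mem).2 hf
    obtain ⟨g, hg, hfg⟩ := ih (dslope f a) hd fun w hw => by
      have hwa : w - a ≠ 0 := sub_ne_zero.2 fun h => ha (h ▸ hw)
      have := hmul w
      rw [h0 w (Finset.mem_insert_of_mem hw)] at this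
      exact (mul_eq_zero.1 this).resolve_left hwa
    refine ⟨g, hg, fun z => ?_⟩
    rw [← hmul, hfg, Finset.prod_insert ha, mul_assoc]

theorem norm_le_mul_pow_card_of_forall_eq_zero {f : ℂ → ℂ} (hf : Differentiable ℂ f)
    {Z : Finset ℂ} (h0 : ∀ w ∈ Z, f w = 0) {r M : ℝ} (hr : 0 < r) (hZ : ∀ w ∈ Z, ‖w‖ ≤ r)
    (hM : ∀ z, ‖z‖ ≤ 7 * r → ‖f z‖ ≤ M) {z : ℂ} (hz : ‖z‖ ≤ r) :
    ‖f z‖ ≤ M * (1 / 3) ^ Z.card := by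
  obtain ⟨g, hg, hfg⟩ := exists_differentiable_eq_prod_sub_mul Z f hf h0
  have hgM : ‖g z‖ ≤ M / (6 * r) ^ Z.card := by
    refine Complex.norm_le_of_forall_mem_frontier_norm_le (U := Metric.ball 0 (7 * r))
      Metric.isBounded_ball hg.diffContOnCl (fun w hw => ?_) (subset_closure ?_)
    · rw [frontier_ball _ (by positivity), mem_sphere_zero_iff_norm] at hw
      rw [le_div_iff₀ (by positivity), mul_comm]
      refine le_trans ?_ (hM w hw.le)
      rw [hfg, norm_mul, norm_prod]
      gcongr
      rw [← Finset.prod_const]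
      refine Finset.prod_le_prod (fun _ _ => by positivity) fun v hv => ?_
      linarith [norm_sub_norm_le w v, hZ v hv]
    · simp only [mem_ball_zero_iff]; linarith
  have hprod : ‖∏ w ∈ Z, (z - w)‖ ≤ (2 * r) ^ Z.card := by
    rw [norm_prod, ← Finset.prod_const]
    refine Finset.prod_le_prod (fun _ _ => norm_nonneg _) fun v hv => ?_
    linarith [norm_sub_le z v, hZ v hv]
  calc ‖f z‖ = ‖∏ w ∈ Z, (z - w)‖ * ‖g z‖ := by rw [hfg, norm_mul]
    _ ≤ (2 * r) ^ Z.card * (M / (6 * r) ^ Z.card) := by gcongr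
    _ = M * (1 / 3) ^ Z.card := by
      rw [mul_div_left_comm, ← div_pow]
      congr 2
      field_simp
      norm_num

open Polynomial in
theorem Polynomial.forall_eq_zero_of_infinite_sum_eq_zero {A : ℕ} (c : Fin A → ℂ) {S : Set ℂ}
    (hS : S.Infinite) (h : ∀ z ∈ S, ∑ s, c s * z ^ (s : ℕ) = 0) (s : Fin A) : c s = 0 := by
  have hp : (∑ s, C (c s) * X ^ (s : ℕ) : ℂ[X]) = 0 :=
    Polynomial.eq_zero_of_infinite_isRoot _ <| hS.mono fun z hz => by
      simpa [IsRoot, eval_finsetSum] using h z hz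
  have := congrArg (fun p : ℂ[X] => p.coeff s) hp
  simpa [finsetSum_coeff, coeff_C_mul, coeff_X_pow, Fin.val_inj] using this

theorem Complex.forall_eq_zero_of_sum_pow_mul_exp_eq_zero {A B : ℕ} {l : ℂ} (hl : l ≠ 0)
    (c : Fin A × Fin B → ℂ)
    (h : ∀ z, ∑ x, c x * (z ^ (x.1 : ℕ) * exp (x.2 * (l * z))) = 0) (x : Fin A × Fin B) :
    c x = 0 := by
  have hpoly (z : ℂ) (s : Fin A) : ∑ t, c (s, t) * exp (t * (l * z)) = 0 := by
    refine Polynomial.forall_eq_zero_of_infinite_sum_eq_zero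
      (fun s => ∑ t, c (s, t) * exp (t * (l * z)))
      (S := Set.range fun m : ℕ => z + m * (2 * Real.pi * I / l))
      (Set.infinite_range_of_injective fun m n hmn => ?_) ?_ s
    · simpa [hl, Real.pi_ne_zero] using hmn
    · rintro _ ⟨m, rfl⟩
      have := h (z + m * (2 * Real.pi * I / l))
      rw [Fintype.sum_prod_type] at this
      rw [← this]
      refine Finset.sum_congr rfl fun s _ => ?_
      rw [Finset.sum_mul]
      refine Finset.sum_congr rfl fun t _ => ?_
      have he : exp (t * (l * (z + m * (2 * Real.pi * I / l)))) = exp (t * (l * z)) := by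
        rw [exp_eq_exp_iff_exists_int]
        refine ⟨t * m, ?_⟩
        push_cast
        field_simp
      dsimp only
      rw [he]
      ring
  obtain ⟨s, t⟩ := x
  refine Polynomial.forall_eq_zero_of_infinite_sum_eq_zero (fun t => c (s, t)) (S := {0}ᶜ)
    (Set.finite_singleton _).infinite_compl (fun y hy => ?_) t
  have := hpoly (log y / l) s
  rw [mul_div_cancel₀ _ hl] at this
  simpa [exp_nat_mul, exp_log hy] using this

open NumberField Module in
theorem NumberField.one_le_norm_mul_house_pow {K : Type*} [Field K] [NumberField K]
    (σ : K →+* ℂ) {x : 𝓞 K} (hx : x ≠ 0) :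
    1 ≤ ‖σ x‖ * house (x : K) ^ (finrank ℚ K - 1) := by
  refine le_trans ?_ (norm_norm_le_norm_mul_house_pow (x : K) σ)
  rw [← Algebra.coe_norm_int, ← Rat.norm_cast_real, Rat.cast_intCast, Int.norm_cast_real,
    Int.norm_eq_abs]
  exact_mod_cast Int.one_le_abs (Algebra.norm_ne_zero_iff.2 hx)

open NumberField Matrix in
theorem NumberField.exists_mulVec_eq_zero_house_le (K : Type*) [Field K] [NumberField K] :
    ∃ c : ℝ, 1 ≤ c ∧ ∀ (ι κ : Type) [Fintype ι] [Fintype κ] (a : Matrix ι κ (𝓞 K)) (A : ℝ),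
      a ≠ 0 → 0 < Fintype.card ι → Fintype.card κ = 2 * Fintype.card ι →
      (∀ i k, house (a i k : K) ≤ A) →
      ∃ ξ : κ → 𝓞 K, ξ ≠ 0 ∧ a *ᵥ ξ = 0 ∧
        ∀ k, house (ξ k : K) ≤ c * Fintype.card κ * A := by
  classical
  obtain ⟨c, hc⟩ : ∃ c : ℝ, ∀ (ι κ : Type) [Fintype ι] [Fintype κ] (a : Matrix ι κ (𝓞 K)) (A : ℝ),
      a ≠ 0 → 0 < Fintype.card ι → Fintype.card κ = 2 * Fintype.card ι →
      (∀ i k, house (a i k : K) ≤ A) →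
      ∃ ξ : κ → 𝓞 K, ξ ≠ 0 ∧ a *ᵥ ξ = 0 ∧
        ∀ k, house (ξ k : K) ≤ c * ((c * Fintype.card κ * A) ^
          ((Fintype.card ι : ℝ) / (Fintype.card κ - Fintype.card ι))) :=
    ⟨_, fun ι κ _ _ a A ha hι hκ hA =>
      house.exists_ne_zero_int_vec_house_le K a ha hι (by lia) rfl hA rfl⟩
  refine ⟨c ^ 2 + 1, by nlinarith [sq_nonneg c], fun ι κ _ _ a A ha hι hκ hA => ?_⟩
  obtain ⟨ξ, hξ, hmul, hle⟩ := hc ι κ a A ha hι hκ hA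
  refine ⟨ξ, hξ, hmul, fun k => (hle k).trans ?_⟩
  have hA0 : 0 ≤ A := by
    obtain ⟨i⟩ := Fintype.card_pos_iff.1 hι
    exact (house_nonneg _).trans (hA i k)
  have hexp : (Fintype.card ι : ℝ) / (Fintype.card κ - Fintype.card ι) = 1 := by
    have : (0 : ℝ) < Fintype.card ι := by exact_mod_cast hι
    rw [hκ]
    push_cast
    field_simp
    ring
  rw [hexp, Real.rpow_one]
  nlinarith [mul_nonneg (Nat.cast_nonneg (α := ℝ) (Fintype.card κ)) hA0]

theorem Real.exists_pow_mul_pow_lt_three_pow_sq {C : ℝ} (hC : 1 ≤ C) (d : ℕ) :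
    ∃ k T : ℕ, 2 ≤ k ∧ 1 ≤ T ∧ ∀ n : ℕ, k * T ≤ n →
      ((C * n) ^ (6 * (k ^ 2 * T)) * C ^ (4 * n * T)) ^ d < 3 ^ n ^ 2 := by
  obtain ⟨k, hk⟩ := exists_nat_ge (max 2 (16 * d * log C))
  have hk2 : 2 ≤ k := by exact_mod_cast (le_max_left _ _).trans hk
  have hkC : 16 * d * log C ≤ k := (le_max_right _ _).trans hk
  have hlim : ∀ᶠ n : ℕ in Filter.atTop, 24 * d * k * log (C * n) ≤ n := by
    have h1 : Filter.Tendsto (fun n : ℕ => C * (n : ℝ)) Filter.atTop Filter.atTop :=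
      tendsto_natCast_atTop_atTop.const_mul_atTop (by positivity)
    have h2 := ((Real.isLittleO_log_id_atTop.comp_tendsto h1).const_mul_left
      (24 * d * k)).bound (c := C⁻¹) (by positivity)
    filter_upwards [h2] with n hn
    refine (le_abs_self _).trans (hn.trans_eq ?_)
    simp [abs_of_nonneg (zero_le_one.trans hC)]
    field_simp
  obtain ⟨T, hT⟩ := Filter.eventually_atTop.1 hlim
  refine ⟨k, T + 1, hk2, by lia, fun n hn => ?_⟩
  have hTn : T ≤ n := by nlinarith
  have hn0 : 0 < n := by nlinarith
  have hnR : (0 : ℝ) < n := by exact_mod_cast hn0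
  have hC0 : 0 < C := by positivity
  have hlogC : 0 ≤ log C := log_nonneg hC
  have hlogCn : 0 ≤ log (C * n) :=
    log_nonneg (one_le_mul_of_one_le_of_one_le hC (by exact_mod_cast hn0))
  have hnk : (k : ℝ) * ((T + 1 : ℕ) : ℝ) ≤ n := by exact_mod_cast hn
  have hkR : (0 : ℝ) < k := by exact_mod_cast (by lia : 0 < k)
  have hlog3 : 1 < log 3 := by
    rw [lt_log_iff_exp_lt (by norm_num)]
    exact exp_one_lt_three
  rw [← log_lt_log_iff (by positivity) (by positivity), log_pow,
    log_mul (by positivity) (by positivity), log_pow, log_pow, log_pow]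
  generalize ((T + 1 : ℕ)) = N at *
  push_cast
  have e1 : d * (6 * ((k : ℝ) ^ 2 * N) * log (C * n)) ≤ n ^ 2 / 4 :=
    calc d * (6 * ((k : ℝ) ^ 2 * N) * log (C * n)) = 6 * d * k * log (C * n) * (k * N) := by ring
      _ ≤ 6 * d * k * log (C * n) * n := by gcongr
      _ = (24 * d * k * log (C * n)) * n / 4 := by ring
      _ ≤ n * n / 4 := by gcongr; exact hT n hTn
      _ = n ^ 2 / 4 := by ring
  have e2 : d * (4 * (n : ℝ) * N * log C) ≤ n ^ 2 / 4 :=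
    calc d * (4 * (n : ℝ) * N * log C) = (16 * d * log C) * N * n / 4 := by ring
      _ ≤ k * N * n / 4 := by gcongr
      _ ≤ n * n / 4 := by gcongr
      _ = n ^ 2 / 4 := by ring
  nlinarith [sq_pos_of_pos hnR]

section Monomials

open NumberField

variable {K : Type*} [Field K] {a b g : K} {D L N n i j s t : ℕ}

theorem isIntegral_pow_mul_monomial (ha : IsIntegral ℤ (D * a)) (hb : IsIntegral ℤ (D * b))
    (hg : IsIntegral ℤ (D * g)) (hi : i ≤ n) (hj : j ≤ n) (hs : s ≤ L) (ht : t ≤ N) :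
    IsIntegral ℤ ((D : K) ^ (L + 2 * n * N) *
      ((i + j * b) ^ s * a ^ (i * t) * g ^ (j * t))) := by
  have hit : i * t ≤ n * N := Nat.mul_le_mul hi ht
  have hjt : j * t ≤ n * N := Nat.mul_le_mul hj ht
  obtain ⟨u, rfl⟩ := Nat.exists_eq_add_of_le hs
  obtain ⟨v, hv⟩ := Nat.exists_eq_add_of_le hit
  obtain ⟨w, hw⟩ := Nat.exists_eq_add_of_le hjt
  have hexp : s + u + 2 * n * N = s + u + (i * t + v) + (j * t + w) := by
    rw [← hv, ← hw]; ring
  have hnat (m : ℕ) : IsIntegral ℤ (m : K) := by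
    simpa using isIntegral_algebraMap (R := ℤ) (A := K) (x := m)
  have heq : (D : K) ^ (s + u + 2 * n * N) * ((i + j * b) ^ s * a ^ (i * t) * g ^ (j * t)) =
      (D : K) ^ (u + v + w) * (D * i + j * (D * b)) ^ s * (D * a) ^ (i * t) *
        (D * g) ^ (j * t) := by
    rw [hexp, show (D * i + j * (D * b) : K) = D * (i + j * b) by ring]
    simp only [mul_pow, pow_add]
    ring
  rw [heq]
  exact ((((hnat D).pow _).mul ((((hnat D).mul (hnat i)).add ((hnat j).mul hb)).pow _)).mul
    (ha.pow _)).mul (hg.pow _)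

theorem NumberField.house_natCast [NumberField K] (m : ℕ) : house (m : K) = m := by
  simpa using house_intCast (K := K) (m : ℤ)

theorem NumberField.house_pow_le_of_le [NumberField K] {x : K} {c : ℝ} (hx : house x ≤ c) (m : ℕ) :
    house (x ^ m) ≤ c ^ m :=
  (house_pow_le x m).trans (pow_le_pow_left₀ (house_nonneg x) hx m)

theorem house_pow_mul_monomial_le [NumberField K] {H C : ℝ} (hH : 1 ≤ H) (hC : 2 * D * H ≤ C)
    (hD : 1 ≤ D) (ha : house a ≤ H) (hb : house b ≤ H) (hg : house g ≤ H)
    (hn : 1 ≤ n) (hi : i ≤ n) (hj : j ≤ n) (hs : s ≤ L) (ht : t ≤ N) :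
    house ((D : K) ^ (L + 2 * n * N) * ((i + j * b) ^ s * a ^ (i * t) * g ^ (j * t))) ≤
      (C * n) ^ L * C ^ (2 * n * N) := by
  have hD' : (1 : ℝ) ≤ D := by exact_mod_cast hD
  have hn' : (1 : ℝ) ≤ n := by exact_mod_cast hn
  have hi' : (i : ℝ) ≤ n := by exact_mod_cast hi
  have hj' : (j : ℝ) ≤ n := by exact_mod_cast hj
  have hDH : 0 ≤ D * H := by positivity
  have hC0 : 0 ≤ C := by linarith
  have h1 : house (i + j * b : K) ≤ 2 * H * n :=
    calc house (i + j * b : K) ≤ i + j * house b := by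
          refine (house_add_le _ _).trans (add_le_add (house_natCast i).le ?_)
          exact (house_mul_le _ _).trans_eq (by rw [house_natCast])
      _ ≤ n + n * H := by gcongr; exact house_nonneg _
      _ ≤ 2 * H * n := by nlinarith
  calc _ ≤ house (D : K) ^ (L + 2 * n * N) *
        (house (i + j * b : K) ^ s * house a ^ (i * t) * house g ^ (j * t)) := by
        refine (house_mul_le _ _).trans
          (mul_le_mul (house_pow_le _ _) ?_ (house_nonneg _) (pow_nonneg (house_nonneg _) _))
        refine (house_mul_le _ _).trans (mul_le_mul ?_ (house_pow_le _ _) (house_nonneg _)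
          (mul_nonneg (pow_nonneg (house_nonneg _) _) (pow_nonneg (house_nonneg _) _)))
        exact (house_mul_le _ _).trans (mul_le_mul (house_pow_le _ _) (house_pow_le _ _)
          (house_nonneg _) (pow_nonneg (house_nonneg _) _))
    _ ≤ (D : ℝ) ^ (L + 2 * n * N) * ((2 * H * n) ^ s * H ^ (i * t) * H ^ (j * t)) := by
        rw [house_natCast]
        have := house_nonneg (i + j * b : K)
        have := house_nonneg a
        have := house_nonneg g
        gcongr
    _ ≤ (D : ℝ) ^ (L + 2 * n * N) * ((2 * H * n) ^ L * H ^ (n * N) * H ^ (n * N)) := by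
        gcongr
        nlinarith
    _ = (2 * D * H * n) ^ L * (D * H) ^ (2 * n * N) := by
        simp only [mul_pow, pow_add]
        ring
    _ ≤ (C * n) ^ L * C ^ (2 * n * N) := by
        gcongr
        linarith

end Monomials

/-- A polynomial in `z` and `exp (l * z)` with coefficients `c`. -/
noncomputable def expPoly {L N : ℕ} (l : ℂ) (c : Fin L × Fin N → ℂ) (z : ℂ) : ℂ :=
  ∑ x, c x * (z ^ (x.1 : ℕ) * Complex.exp (x.2 * (l * z)))

section expPoly

variable {L N : ℕ} {l : ℂ} {c : Fin L × Fin N → ℂ}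

theorem differentiable_expPoly : Differentiable ℂ (expPoly l c) := by
  unfold expPoly
  fun_prop

theorem norm_expPoly_le {M R : ℝ} (hc : ∀ x, ‖c x‖ ≤ M) (hR : 1 ≤ R) {z : ℂ} (hz : ‖z‖ ≤ R) :
    ‖expPoly l c z‖ ≤ (L * N) * M * (R ^ L * Real.exp (‖l‖ * R) ^ N) := by
  have hterm (x : Fin L × Fin N) : ‖c x * (z ^ (x.1 : ℕ) * Complex.exp (x.2 * (l * z)))‖ ≤
      M * (R ^ L * Real.exp (‖l‖ * R) ^ N) := by
    have hM : 0 ≤ M := (norm_nonneg _).trans (hc x)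
    rw [norm_mul, norm_mul, norm_pow]
    gcongr
    · exact hc x
    · calc ‖z‖ ^ (x.1 : ℕ) ≤ R ^ (x.1 : ℕ) := by gcongr
        _ ≤ R ^ L := pow_le_pow_right₀ hR x.1.2.le
    · rw [Complex.exp_nat_mul, norm_pow]
      calc ‖Complex.exp (l * z)‖ ^ (x.2 : ℕ) ≤ Real.exp (‖l‖ * R) ^ (x.2 : ℕ) := by
            gcongr
            refine (Complex.norm_exp_le_exp_norm _).trans ?_
            rw [norm_mul]
            gcongr
        _ ≤ Real.exp (‖l‖ * R) ^ N :=
            pow_le_pow_right₀ (Real.one_le_exp (by positivity)) x.2.2.le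
  calc ‖expPoly l c z‖ ≤ ∑ _x : Fin L × Fin N, M * (R ^ L * Real.exp (‖l‖ * R) ^ N) :=
        norm_sum_le_of_le _ fun x _ => hterm x
    _ = (L * N) * M * (R ^ L * Real.exp (‖l‖ * R) ^ N) := by
        simp
        ring

theorem norm_expPoly_le_of_vanishing {β : ℂ} (hβ : ∀ q : ℚ, (q : ℂ) ≠ β) {M H C : ℝ} {D n : ℕ}
    (hc : ∀ x, ‖c x‖ ≤ M) (hM : 0 ≤ M) (hH : 1 ≤ H) (hβH : ‖β‖ ≤ H) (hD : 1 ≤ D) (hn : 1 ≤ n)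
    (hC : 14 * D * H ≤ C) (hCl : D * Real.exp (14 * H * ‖l‖) ≤ C)
    (h0 : ∀ i < n, ∀ j < n, expPoly l c (i + j * β) = 0) {z : ℂ} (hz : ‖z‖ ≤ 2 * H * n) :
    (D : ℝ) ^ (L + 2 * n * N) * ‖expPoly l c z‖ ≤
      (L * N) * M * ((C * n) ^ L * C ^ (2 * n * N)) * (1 / 3) ^ n ^ 2 := by
  classical
  have hD' : (1 : ℝ) ≤ D := by exact_mod_cast hD
  have hn' : (1 : ℝ) ≤ n := by exact_mod_cast hn
  have hC0 : 0 ≤ C := le_trans (by positivity) hC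
  have hinj : Function.Injective fun p : ℕ × ℕ => (p.1 + p.2 * β : ℂ) := by
    rintro ⟨i, j⟩ ⟨i', j'⟩ h
    dsimp only at h
    have hjj : j = j' := by
      by_contra hne
      have hne' : (j - j' : ℂ) ≠ 0 := sub_ne_zero.2 (by exact_mod_cast hne)
      refine hβ ((i' - i) / (j - j')) ?_
      push_cast
      rw [div_eq_iff hne']
      linear_combination -h
    subst hjj
    simpa using h
  set Z : Finset ℂ := (Finset.range n ×ˢ Finset.range n).image
    fun p : ℕ × ℕ => (p.1 + p.2 * β : ℂ) with hZdef
  have hcard : Z.card = n ^ 2 := by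
    rw [hZdef, Finset.card_image_of_injective _ hinj, Finset.card_product, Finset.card_range, sq]
  have hmem (w) (hw : w ∈ Z) : ∃ i < n, ∃ j < n, (i + j * β : ℂ) = w := by
    simp only [hZdef, Finset.mem_image, Finset.mem_product, Finset.mem_range] at hw
    obtain ⟨p, ⟨h1, h2⟩, rfl⟩ := hw
    exact ⟨p.1, h1, p.2, h2, rfl⟩
  have key := norm_le_mul_pow_card_of_forall_eq_zero (differentiable_expPoly (l := l) (c := c))
    (Z := Z) (r := 2 * H * n) (M := (L * N) * M * ((14 * H * n) ^ L *
      Real.exp (‖l‖ * (14 * H * n)) ^ N)) ?_ (by positivity) ?_ ?_ hz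
  · rw [hcard] at key
    have hexp : (D : ℝ) ^ (2 * n * N) * Real.exp (‖l‖ * (14 * H * n)) ^ N ≤ C ^ (2 * n * N) := by
      have h1 : Real.exp (‖l‖ * (14 * H * n)) ^ N = Real.exp (14 * H * ‖l‖) ^ (n * N) := by
        rw [← Real.exp_nat_mul, ← Real.exp_nat_mul]
        push_cast
        ring_nf
      have h2 : Real.exp (14 * H * ‖l‖) ^ (n * N) ≤ Real.exp (14 * H * ‖l‖) ^ (2 * n * N) :=
        pow_le_pow_right₀ (Real.one_le_exp (by positivity)) (by lia)
      calc _ ≤ (D : ℝ) ^ (2 * n * N) * Real.exp (14 * H * ‖l‖) ^ (2 * n * N) := by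
            rw [h1]; gcongr
        _ = (D * Real.exp (14 * H * ‖l‖)) ^ (2 * n * N) := (mul_pow _ _ _).symm
        _ ≤ C ^ (2 * n * N) := by gcongr
    calc _ ≤ (D : ℝ) ^ (L + 2 * n * N) * ((L * N) * M * ((14 * H * n) ^ L *
          Real.exp (‖l‖ * (14 * H * n)) ^ N) * (1 / 3) ^ n ^ 2) := by gcongr
      _ = (L * N) * M * ((14 * D * H * n) ^ L * ((D : ℝ) ^ (2 * n * N) *
          Real.exp (‖l‖ * (14 * H * n)) ^ N)) * (1 / 3) ^ n ^ 2 := by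
        simp only [mul_pow, pow_add]
        ring
      _ ≤ (L * N) * M * ((C * n) ^ L * C ^ (2 * n * N)) * (1 / 3) ^ n ^ 2 := by gcongr
  · intro w hw
    obtain ⟨i, hi, j, hj, rfl⟩ := hmem w hw
    exact h0 i hi j hj
  · intro w hw
    obtain ⟨i, hi, j, hj, rfl⟩ := hmem w hw
    have hi' : (i : ℝ) ≤ n := by exact_mod_cast hi.le
    have hj' : (j : ℝ) ≤ n := by exact_mod_cast hj.le
    calc ‖(i + j * β : ℂ)‖ ≤ i + j * ‖β‖ := by
          simpa using norm_add_le (i : ℂ) (j * β)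
      _ ≤ n + n * H := by gcongr
      _ ≤ 2 * H * n := by nlinarith
  · intro w hw
    exact norm_expPoly_le hc (by nlinarith) (hw.trans_eq (by ring))

end expPoly

theorem exists_natCast_mul_isIntegral {K : Type*} [Field K] [NumberField K] (a b g : K) :
    ∃ D : ℕ, 1 ≤ D ∧ IsIntegral ℤ (D * a) ∧ IsIntegral ℤ (D * b) ∧ IsIntegral ℤ (D * g) := by
  classical
  have : Algebra.IsAlgebraic ℤ K := (IsFractionRing.comap_isAlgebraic_iff (K := ℚ)).2 inferInstance
  obtain ⟨y, hy, h⟩ := Algebra.IsAlgebraic.exists_integral_multiples ℤ ({a, b, g} : Finset K)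
  have hint (x : K) (hx : x ∈ ({a, b, g} : Finset K)) : IsIntegral ℤ ((y.natAbs : K) * x) := by
    have h1 := (h x hx).smul (Int.sign y)
    rw [smul_smul, Int.sign_mul_self_eq_natAbs] at h1
    simpa using h1
  exact ⟨y.natAbs, Int.natAbs_pos.2 hy, hint a (by simp), hint b (by simp), hint g (by simp)⟩

theorem mul_le_pow_mul_sq {c q b B C n : ℝ} {L : ℕ} (hc : 0 ≤ c) (hq : 0 ≤ q)
    (hb : 0 ≤ b) (hbB : b ≤ B) (hqn : q ≤ 2 * n ^ 2) (hcC : 4 * c ≤ C) (hC : 1 ≤ C) (hn : 1 ≤ n)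
    (hL : 5 ≤ L) : n * (q * (c * q * b) * B) ≤ (C * n) ^ L * B ^ 2 := by
  have hB : 0 ≤ B := hb.trans hbB
  calc n * (q * (c * q * b) * B) = n * (c * q ^ 2 * b * B) := by ring
    _ ≤ n * (c * (2 * n ^ 2) ^ 2 * B * B) := by gcongr
    _ = (4 * c) * n ^ 5 * B ^ 2 := by ring
    _ ≤ C ^ 5 * n ^ 5 * B ^ 2 := by
      gcongr
      exact hcC.trans (le_self_pow₀ hC (by norm_num))
    _ = (C * n) ^ 5 * B ^ 2 := by ring
    _ ≤ (C * n) ^ L * B ^ 2 := by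
      gcongr
      exact one_le_mul_of_one_le_of_one_le hC hn

section AuxiliaryFunction

open NumberField Module

variable {K : Type*} [Field K] [NumberField K] {σ : K →+* ℂ} {a b g : K} {l : ℂ}

theorem expPoly_map_eq {L N : ℕ} (ha : Complex.exp l = σ a) (hg : Complex.exp (σ b * l) = σ g)
    (ξ : Fin L × Fin N → K) (i j : ℕ) :
    expPoly l (fun x => σ (ξ x)) (i + j * σ b) =
      σ (∑ x, ξ x * ((i + j * b) ^ (x.1 : ℕ) * a ^ (i * x.2) * g ^ (j * x.2))) := by
  simp only [expPoly, map_sum, map_mul, map_pow, map_add, map_natCast, ← ha, ← hg,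
    ← Complex.exp_nat_mul]
  refine Finset.sum_congr rfl fun x _ => ?_
  rw [mul_assoc _ (Complex.exp _), ← Complex.exp_add]
  congr 3
  push_cast
  ring

set_option maxHeartbeats 1000000 in
theorem exp_map_mul_ne_map (σ : K →+* ℂ) (hl : l ≠ 0) (ha : Complex.exp l = σ a)
    (hb : ∀ q : ℚ, (q : ℂ) ≠ σ b) : Complex.exp (σ b * l) ≠ σ g := by
  intro hg
  obtain ⟨D, hD, hDa, hDb, hDg⟩ := exists_natCast_mul_isIntegral a b g
  obtain ⟨c, hc1, hc⟩ := exists_mulVec_eq_zero_house_le K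
  set H : ℝ := 1 + house a + house b + house g with hHdef
  have hha := house_nonneg a
  have hhb := house_nonneg b
  have hhg := house_nonneg g
  have hH : 1 ≤ H := by linarith
  have hD' : (1 : ℝ) ≤ D := by exact_mod_cast hD
  set C : ℝ := 14 * D * H + D * Real.exp (14 * H * ‖l‖) + 4 * c with hCdef
  have hDH : 1 ≤ D * H := one_le_mul_of_one_le_of_one_le hD' hH
  have hE : 0 ≤ D * Real.exp (14 * H * ‖l‖) := by positivity
  have hC14 : 14 * D * H ≤ C := by linarith
  have hC2 : 2 * D * H ≤ C := by linarith
  have hCl : D * Real.exp (14 * H * ‖l‖) ≤ C := by linarith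
  have hC1 : 1 ≤ C := by linarith
  have hC4 : 4 * c ≤ C := by linarith
  obtain ⟨k, T, hk, hT, hgrowth⟩ := Real.exists_pow_mul_pow_lt_three_pow_sq hC1 (finrank ℚ K)
  set S := k * T with hS
  set L := 2 * (k ^ 2 * T) with hL
  have hS1 : 1 ≤ S := Nat.mul_pos (by lia) hT
  have hL8 : 8 ≤ L := by nlinarith
  have hLT : L * T = 2 * (S * S) := by rw [hL, hS]; ring
  set B : ℕ → ℝ := fun n => (C * n) ^ L * C ^ (2 * n * T) with hB
  have hBmono {m n : ℕ} (hmn : m ≤ n) : B m ≤ B n := by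
    simp only [hB]
    gcongr
  let e (n i j : ℕ) (x : Fin L × Fin T) : K :=
    (D : K) ^ (L + 2 * n * T) * ((i + j * b) ^ (x.1 : ℕ) * a ^ (i * x.2) * g ^ (j * x.2))
  have he_int {n i j : ℕ} (hi : i ≤ n) (hj : j ≤ n) (x) : IsIntegral ℤ (e n i j x) :=
    isIntegral_pow_mul_monomial hDa hDb hDg hi hj x.1.2.le x.2.2.le
  have he_house {n i j : ℕ} (hn : 1 ≤ n) (hi : i ≤ n) (hj : j ≤ n) (x) :
      house (e n i j x) ≤ B n :=
    house_pow_mul_monomial_le hH hC2 hD (by linarith) (by linarith) (by linarith) hn hi hj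
      x.1.2.le x.2.2.le
  have hlift {n i j : ℕ} (hi : i ≤ n) (hj : j ≤ n) :
      ∃ f : Fin L × Fin T → 𝓞 K, ∀ x, (f x : K) = e n i j x :=
    ⟨fun x => ⟨_, he_int hi hj x⟩, fun x => rfl⟩
  choose m hm using fun p : Fin S × Fin S => hlift p.1.2.le p.2.2.le
  obtain ⟨ξ, hξ0, hξ, hξle⟩ := hc (Fin S × Fin S) (Fin L × Fin T) m (B S)
    (fun h => by
      have h1 := hm (⟨0, hS1⟩, ⟨0, hS1⟩) (⟨0, by lia⟩, ⟨0, hT⟩)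
      have hD0 : D ≠ 0 := by lia
      simp [h, e] at h1
      exact pow_ne_zero _ (Nat.cast_ne_zero.2 hD0) h1.symm)
    (by simpa using by lia) (by simpa using hLT)
    (fun p x => by rw [hm]; exact he_house hS1 p.1.2.le p.2.2.le x)
  simp only [Fintype.card_prod, Fintype.card_fin] at hξle
  set q : ℝ := L * T with hq
  have hqcast : ((L * T : ℕ) : ℝ) = q := by simp [hq]
  rw [hqcast] at hξle
  set M : ℝ := c * q * B S with hM
  have hq1 : 1 ≤ q := by rw [← hqcast]; exact_mod_cast (by nlinarith : 1 ≤ L * T)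
  have hB1 {n : ℕ} (hn : 1 ≤ n) : 1 ≤ B n := by
    have hn' : (1 : ℝ) ≤ n := by exact_mod_cast hn
    exact one_le_mul_of_one_le_of_one_le
      (one_le_pow₀ (one_le_mul_of_one_le_of_one_le hC1 hn')) (one_le_pow₀ hC1)
  have hM1 : 1 ≤ M := one_le_mul_of_one_le_of_one_le
    (one_le_mul_of_one_le_of_one_le hc1 hq1) (hB1 hS1)
  set F := expPoly l (fun x => σ (ξ x : K)) with hF
  have hξM (x) : ‖σ (ξ x : K)‖ ≤ M := (norm_embedding_le_house _ σ).trans (hξle x)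
  have hsum (n i j : ℕ) : σ (∑ x, (ξ x : K) * e n i j x) =
      (D : ℂ) ^ (L + 2 * n * T) * F (i + j * σ b) := by
    rw [hF, expPoly_map_eq ha hg, ← map_natCast σ D, ← map_pow, ← map_mul, Finset.mul_sum]
    congr 1
    exact Finset.sum_congr rfl fun x _ => mul_left_comm _ _ _
  have hP1 {n : ℕ} (hn : 1 ≤ n) : 1 ≤ q * M * B n :=
    one_le_mul_of_one_le_of_one_le (one_le_mul_of_one_le_of_one_le hq1 hM1) (hB1 hn)
  have hP {n : ℕ} (hn : S ≤ n) : (n * (q * M * B n)) ^ finrank ℚ K < 3 ^ n ^ 2 := by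
    refine lt_of_le_of_lt ?_ (hgrowth n hn)
    have hqn : q ≤ 2 * (n : ℝ) ^ 2 := by
      rw [← hqcast, hLT]
      push_cast
      have : (S : ℝ) ≤ n := by exact_mod_cast hn
      nlinarith
    have hn1 : (1 : ℝ) ≤ n := by exact_mod_cast hS1.trans hn
    have hP0 := zero_le_one.trans (hP1 (hS1.trans hn))
    refine pow_le_pow_left₀ (mul_nonneg (Nat.cast_nonneg n) hP0) ?_ _
    refine (mul_le_pow_mul_sq (zero_le_one.trans hc1) (zero_le_one.trans hq1)
      (zero_le_one.trans (hB1 hS1)) (hBmono hn) hqn hC4 hC1 hn1 (by lia : 5 ≤ L)).trans_eq ?_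
    rw [show 6 * (k ^ 2 * T) = L + L * 2 by rw [hL]; ring,
      show 4 * n * T = (2 * n * T) * 2 by ring]
    simp only [hB, pow_add, pow_mul, mul_pow]
    ring
  have hbH : ‖σ b‖ ≤ H := (norm_embedding_le_house b σ).trans (by linarith)
  have hsmall {n : ℕ} (hn : S ≤ n) (h0 : ∀ i < n, ∀ j < n, F (i + j * σ b) = 0) {z : ℂ}
      (hz : ‖z‖ ≤ 2 * H * n) :
      (D : ℝ) ^ (L + 2 * n * T) * ‖F z‖ ≤ q * M * B n * (1 / 3) ^ n ^ 2 :=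
    norm_expPoly_le_of_vanishing hb hξM (zero_le_one.trans hM1) hH hbH hD (hS1.trans hn) hC14 hCl
      h0 hz
  have hvanish (n : ℕ) (hn : S ≤ n) : ∀ i < n, ∀ j < n, F (i + j * σ b) = 0 := by
    induction n, hn using Nat.le_induction with
    | base =>
      intro i hi j hj
      have h1 := congrFun hξ (⟨i, hi⟩, ⟨j, hj⟩)
      have h2 : ∑ x, (ξ x : K) * e S i j x = 0 := by
        have := congrArg (algebraMap (𝓞 K) K) h1
        simpa [Matrix.mulVec, dotProduct, hm, mul_comm] using this
      have h3 := hsum S i j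
      rw [h2, map_zero, eq_comm, mul_eq_zero] at h3
      refine h3.resolve_left (pow_ne_zero _ ?_)
      exact_mod_cast (by lia : D ≠ 0)
    | succ n hn ih =>
      intro i hi j hj
      have hi : i ≤ n := Nat.lt_succ_iff.1 hi
      have hj : j ≤ n := Nat.lt_succ_iff.1 hj
      have hn1 : 1 ≤ n := hS1.trans hn
      have hi' : (i : ℝ) ≤ n := by exact_mod_cast hi
      have hj' : (j : ℝ) ≤ n := by exact_mod_cast hj
      have hn1' : (1 : ℝ) ≤ n := by exact_mod_cast hn1
      obtain ⟨y, hy⟩ : ∃ y : 𝓞 K, (y : K) = ∑ x, (ξ x : K) * e n i j x := by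
        obtain ⟨f, hf⟩ := hlift hi hj
        exact ⟨∑ x, ξ x * f x, by simp [hf]⟩
      have hyσ := hsum n i j
      rw [← hy] at hyσ
      have hz : ‖(i + j * σ b : ℂ)‖ ≤ 2 * H * n :=
        calc ‖(i + j * σ b : ℂ)‖ ≤ i + j * ‖σ b‖ := by
              simpa using norm_add_le (i : ℂ) (j * σ b)
          _ ≤ n + n * H := by gcongr
          _ ≤ 2 * H * n := by nlinarith
      have hynorm : ‖σ y‖ ≤ q * M * B n * (1 / 3) ^ n ^ 2 := by
        rw [hyσ]
        simpa using hsmall hn ih hz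
      have hyhouse : house (y : K) ≤ q * M * B n := by
        rw [hy]
        calc house (∑ x, (ξ x : K) * e n i j x) ≤ ∑ x, house ((ξ x : K) * e n i j x) :=
              house_sum_le_sum_house _ _
          _ ≤ ∑ _x : Fin L × Fin T, M * B n :=
            Finset.sum_le_sum fun x _ => (house_mul_le _ _).trans
              (mul_le_mul (hξle x) (he_house hn1 hi hj x) (house_nonneg _) (by positivity))
          _ = q * M * B n := by simp [hq, mul_assoc]
      by_cases hy0 : y = 0
      · rw [hy0] at hyσ
        simp only [map_zero] at hyσ
        rw [eq_comm, mul_eq_zero] at hyσ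
        refine hyσ.resolve_left (pow_ne_zero _ ?_)
        exact_mod_cast (by lia : D ≠ 0)
      · exfalso
        have hP0 : 0 ≤ q * M * B n := zero_le_one.trans (hP1 hn1)
        have h1 := one_le_norm_mul_house_pow σ hy0
        have h2 : ‖σ y‖ * house (y : K) ^ (finrank ℚ K - 1) ≤
            (q * M * B n) ^ finrank ℚ K * (1 / 3) ^ n ^ 2 :=
          calc _ ≤ (q * M * B n * (1 / 3) ^ n ^ 2) * (q * M * B n) ^ (finrank ℚ K - 1) := by
                have := house_nonneg (y : K)
                gcongr
            _ = (q * M * B n) ^ finrank ℚ K * (1 / 3) ^ n ^ 2 := by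
                rw [← mul_pow_sub_one (finrank_pos (R := ℚ) (M := K)).ne' (q * M * B n)]
                ring
        have h3 : (q * M * B n) ^ finrank ℚ K < 3 ^ n ^ 2 := by
          refine lt_of_le_of_lt ?_ (hP hn)
          exact pow_le_pow_left₀ hP0 (le_mul_of_one_le_left hP0 hn1') _
        have h4 : (q * M * B n) ^ finrank ℚ K * (1 / 3) ^ n ^ 2 < 1 := by
          rw [one_div, inv_pow, ← div_eq_mul_inv, div_lt_one (by positivity)]
          exact h3
        linarith
  have hFzero (z : ℂ) : F z = 0 := by
    by_contra hne
    obtain ⟨n, hn⟩ := exists_nat_ge (‖z‖ + ‖F z‖⁻¹ + S)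
    have hFpos : 0 < ‖F z‖ := norm_pos_iff.2 hne
    have hFinv : 0 < ‖F z‖⁻¹ := inv_pos.2 hFpos
    have hz0 := norm_nonneg z
    have hS0 : (0 : ℝ) ≤ S := Nat.cast_nonneg S
    have hSn : S ≤ n := by exact_mod_cast (by linarith : (S : ℝ) ≤ n)
    have hn1 : 1 ≤ n := hS1.trans hSn
    have hn1' : (1 : ℝ) ≤ n := by exact_mod_cast hn1
    have h1 := hsmall hSn (hvanish n hSn) (z := z) (by nlinarith)
    have h2 : ‖F z‖ ≤ (D : ℝ) ^ (L + 2 * n * T) * ‖F z‖ :=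
      le_mul_of_one_le_left (norm_nonneg _) (one_le_pow₀ hD')
    have h3 : n * (q * M * B n) < 3 ^ n ^ 2 :=
      (le_self_pow₀ (one_le_mul_of_one_le_of_one_le hn1' (hP1 hn1))
        (finrank_pos (R := ℚ) (M := K)).ne').trans_lt (hP hSn)
    have h4 : n * (q * M * B n * (1 / 3) ^ n ^ 2) < 1 := by
      rw [← mul_assoc, one_div, inv_pow, ← div_eq_mul_inv, div_lt_one (by positivity)]
      exact h3
    have h5 : 1 ≤ n * ‖F z‖ :=
      calc 1 = ‖F z‖⁻¹ * ‖F z‖ := (inv_mul_cancel₀ hFpos.ne').symm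
        _ ≤ n * ‖F z‖ := by gcongr; linarith
    have h6 : n * ‖F z‖ ≤ n * (q * M * B n * (1 / 3) ^ n ^ 2) := by
      gcongr
      exact h2.trans h1
    linarith
  refine hξ0 (funext fun x => ?_)
  have := Complex.forall_eq_zero_of_sum_pow_mul_exp_eq_zero hl _ hFzero x
  simpa using this

end AuxiliaryFunction

/-- Gelfond–Schneider solution of Hilbert's seventh problem: if `α ≠ 0, 1` and `β` are
algebraic over `ℚ` and `β` is irrational, then `α^β = exp(β·l)` (for any complex
logarithm `l` of `α`) is transcendental over `ℚ`. -/
theorem gelfond_schneider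
    (α β l : ℂ) (hl : Complex.exp l = α) (h0 : α ≠ 0) (h1 : α ≠ 1)
    (hα : IsAlgebraic ℚ α) (hβ : IsAlgebraic ℚ β)
    (hirr : ∀ q : ℚ, (q : ℂ) ≠ β) :
    Transcendental ℚ (Complex.exp (β * l)) := by
  intro hγ
  subst hl
  have hl0 : l ≠ 0 := by
    rintro rfl
    exact h1 Complex.exp_zero
  let K := IntermediateField.adjoin ℚ {Complex.exp l, β, Complex.exp (β * l)}
  have hfin : FiniteDimensional ℚ K := by
    refine IntermediateField.finiteDimensional_adjoin fun x hx => ?_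
    simp only [Set.mem_insert_iff, Set.mem_singleton_iff] at hx
    rcases hx with rfl | rfl | rfl
    exacts [hα.isIntegral, hβ.isIntegral, hγ.isIntegral]
  have : NumberField K := ⟨⟩
  have hmem {x : ℂ} (hx : x ∈ ({Complex.exp l, β, Complex.exp (β * l)} : Set ℂ)) : x ∈ K :=
    IntermediateField.subset_adjoin ℚ _ hx
  let a : K := ⟨_, hmem (.inl rfl)⟩
  let b : K := ⟨β, hmem (.inr (.inl rfl))⟩
  let g : K := ⟨_, hmem (.inr (.inr rfl))⟩
  exact exp_map_mul_ne_map (a := a) (b := b) (g := g) (algebraMap K ℂ) hl0 rfl hirr rfl
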